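/- arXiv:2410.03760 — 2 statements merged into one kernel-verified Lean document; each statement's English description precedes it below -/
import Mathlib

section
/- Let (Z_n)_{n≥1} be a sequence of nonnegative real numbers satisfying, for all n ≥ 1, Z_{n+1} ≤ (1 − a/(n+1)^α) Z_n + b/(n+1)^β, where a, b, α, β are positive constants with a ≤ 2^α, α ≤ 1, 1 < β < 2, β ≤ 2α, and in the special case α = 1 also β < a + 1. Then there exists a positive constant C such that for all n ≥ 1, Z_n ≤ C / n^{β−α}. -/
open MeasureTheory ProbabilityTheory Filter
open scoped RealInnerProductSpace ENNReal NNReal Topology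

set_option autoImplicit false

/-- For `α < 1`, or for `α = 1` and `γ < a`, the ratio `γ * (n + 1) ^ α / n` is eventually bounded
by a constant smaller than `a`. -/
lemma exists_lt_eventually_mul_rpow_le (a α γ : ℝ) (ha : 0 < a) (hα1 : α ≤ 1) (hγ : 0 < γ)
    (hγa : α = 1 → γ < a) :
    ∃ c < a, ∀ᶠ n : ℕ in atTop, γ * ((n : ℝ) + 1) ^ α ≤ c * n := by
  have hcast : Tendsto (fun n : ℕ => (n : ℝ)) atTop atTop := tendsto_natCast_atTop_atTop
  rcases hα1.lt_or_eq with h | rfl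
  · refine ⟨a / 2, half_lt_self ha, ?_⟩
    have hlim := (tendsto_rpow_neg_atTop (sub_pos.2 h)).comp
      (tendsto_atTop_add_const_right atTop (1 : ℝ) hcast)
    filter_upwards [hlim.eventually_le_const (show 0 < a / (4 * γ) by positivity),
      eventually_ge_atTop 1] with n hn hn1
    have hn1' : (1 : ℝ) ≤ n := by exact_mod_cast hn1
    have hpos : (0 : ℝ) < n + 1 := by positivity
    replace hn : ((n : ℝ) + 1) ^ α ≤ a / (4 * γ) * (n + 1) := by
      simpa [neg_sub, Real.rpow_sub_one hpos.ne', div_le_iff₀ hpos] using hn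
    calc γ * ((n : ℝ) + 1) ^ α ≤ γ * (a / (4 * γ) * (n + 1)) := by gcongr
      _ = a / 4 * (n + 1) := by field_simp
      _ ≤ a / 2 * n := by nlinarith
  · have hlt := hγa rfl
    refine ⟨(γ + a) / 2, by linarith, ?_⟩
    filter_upwards [hcast.eventually_ge_atTop (2 * γ / (a - γ))] with n hn
    rw [div_le_iff₀ (by linarith)] at hn
    rw [Real.rpow_one]
    linarith

/-- The bound `C / n ^ γ` is propagated by one step of the recursion. -/
lemma recursion_step_le {a b c C α γ x : ℝ} (hx : 0 < x) (hγ : 0 ≤ γ) (hγ1 : γ ≤ 1)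
    (hC : 0 ≤ C) (hbC : b ≤ (a - c) * C) (ha : 0 ≤ a)
    (hcoef : a / (x + 1) ^ α ≤ 1) (hstep : γ * (x + 1) ^ α ≤ c * x) :
    (1 - a / (x + 1) ^ α) * (C / x ^ γ) + b / (x + 1) ^ (α + γ) ≤ C / (x + 1) ^ γ := by
  have hx1 : 0 < x + 1 := by linarith
  have hP : 0 < (x + 1) ^ α := Real.rpow_pos_of_pos hx1 α
  have hQ : 0 < (x + 1) ^ γ := Real.rpow_pos_of_pos hx1 γ
  have hR : 0 < x ^ γ := Real.rpow_pos_of_pos hx γ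
  have hratio : (x + 1) ^ γ / x ^ γ ≤ 1 + γ * (1 / x) := by
    rw [← Real.div_rpow hx1.le hx.le, add_div, div_self hx.ne']
    exact rpow_one_add_le_one_add_mul_self (by linarith [one_div_pos.2 hx]) hγ hγ1
  have hdrift : γ * (1 / x) ≤ c / (x + 1) ^ α := by
    rw [mul_one_div, div_le_div_iff₀ hx hP]
    exact hstep
  have hbC' : b / (x + 1) ^ α ≤ (a / (x + 1) ^ α - c / (x + 1) ^ α) * C := by
    rw [← sub_div, div_mul_eq_mul_div]
    gcongr
  have hA : 0 ≤ a / (x + 1) ^ α := by positivity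
  have hD : 0 ≤ γ * (1 / x) := by positivity
  have key : (1 - a / (x + 1) ^ α) * (C * ((x + 1) ^ γ / x ^ γ)) + b / (x + 1) ^ α ≤ C := by
    have h₁ : (1 - a / (x + 1) ^ α) * (C * ((x + 1) ^ γ / x ^ γ)) ≤
        (1 - a / (x + 1) ^ α) * (C * (1 + γ * (1 / x))) :=
      mul_le_mul_of_nonneg_left (mul_le_mul_of_nonneg_left hratio hC) (by linarith)
    nlinarith [mul_nonneg hC (mul_nonneg hA hD), mul_le_mul_of_nonneg_left hdrift hC]
  rw [Real.rpow_add hx1, le_div_iff₀ hQ]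
  refine le_of_eq_of_le ?_ key
  field_simp

theorem saga_stmt5 (Z : ℕ → ℝ) (hZ : ∀ n, 1 ≤ n → 0 ≤ Z n)
    (a b α β : ℝ) (ha : 0 < a) (hb : 0 < b) (hα : 0 < α) (hβ : 0 < β)
    (ha2 : a ≤ (2 : ℝ) ^ α) (hα1 : α ≤ 1) (hβ1 : 1 < β) (hβ2 : β < 2)
    (hβα : β ≤ 2 * α) (hspec : α = 1 → β < a + 1)
    (hrec : ∀ n : ℕ, 1 ≤ n →
      Z (n + 1) ≤ (1 - a / ((n : ℝ) + 1) ^ α) * Z n + b / ((n : ℝ) + 1) ^ β) :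
    ∃ C : ℝ, 0 < C ∧ ∀ n : ℕ, 1 ≤ n → Z n ≤ C / (n : ℝ) ^ (β - α) := by
  obtain ⟨c, hca, hc⟩ := exists_lt_eventually_mul_rpow_le a α (β - α) ha hα1 (by linarith)
    (fun h => by linarith [hspec h])
  obtain ⟨N, hN⟩ := eventually_atTop.1 hc
  have hac : 0 < a - c := sub_pos.2 hca
  set S := ∑ i ∈ Finset.range (N + 2), |Z i| * (i : ℝ) ^ (β - α)
  have hterm : ∀ i : ℕ, 0 ≤ |Z i| * (i : ℝ) ^ (β - α) := fun i => by positivity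
  have hS0 : 0 ≤ S := Finset.sum_nonneg fun i _ => hterm i
  have hbac : 0 < b / (a - c) := div_pos hb hac
  have hinit : ∀ n : ℕ, 1 ≤ n → n < N + 2 → Z n ≤ (b / (a - c) + S) / (n : ℝ) ^ (β - α) := by
    intro n hn1 hn
    have hn0 : (0 : ℝ) < n := by exact_mod_cast hn1
    rw [le_div_iff₀ (Real.rpow_pos_of_pos hn0 _)]
    calc Z n * (n : ℝ) ^ (β - α) ≤ |Z n| * (n : ℝ) ^ (β - α) := by gcongr; exact le_abs_self _
      _ ≤ S := Finset.single_le_sum (f := fun i : ℕ => |Z i| * (i : ℝ) ^ (β - α))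
          (fun i _ => hterm i) (Finset.mem_range.2 hn)
      _ ≤ b / (a - c) + S := by linarith
  refine ⟨b / (a - c) + S, by linarith, fun n hn => ?_⟩
  induction n, hn using Nat.le_induction with
  | base => exact hinit 1 le_rfl (by omega)
  | succ n hn ih =>
    rcases lt_or_ge (n + 1) (N + 2) with h | h
    · exact hinit (n + 1) (by omega) h
    have hn1 : (1 : ℝ) ≤ n := by exact_mod_cast hn
    have hcoef : a / ((n : ℝ) + 1) ^ α ≤ 1 := by
      rw [div_le_one (by positivity)]
      exact ha2.trans (Real.rpow_le_rpow zero_le_two (by linarith) hα.le)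
    have hbC : b ≤ (a - c) * (b / (a - c) + S) := by
      rw [mul_add, mul_div_cancel₀ _ hac.ne']
      linarith [mul_nonneg hac.le hS0]
    have hstep := recursion_step_le (b := b) (by linarith) (by linarith) (by linarith)
      (by linarith) hbC ha.le hcoef (hN n (by omega))
    rw [add_sub_cancel] at hstep
    push_cast
    exact ((hrec n hn).trans (by gcongr)).trans hstep
end

section
/- Let p be a positive even integer. There exist positive constants C_p and D_p such that for all vectors a, b ∈ ℝ^d, ‖a + b‖^{2+p} ≤ ‖a‖^{2+p} + (2+p)⟨a, b⟩‖a‖^p + C_p ‖a‖^p ‖b‖² + D_p ‖b‖^{2+p}. Moreover one may take the constants defined recursively by C_2 = 8, D_2 = 3 and, for even p ≥ 4, C_p = 3p + (4/p)((p−1)C_{p−2} + D_{p−2}) and D_p = 1 + (4/p)(C_{p−2} + (p−1)D_{p−2}). -/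
open MeasureTheory ProbabilityTheory Filter
open scoped RealInnerProductSpace ENNReal NNReal Topology

set_option autoImplicit false

/-- The constants `(C_p, D_p)` for `p = 2 * (m + 1)`, defined recursively by
`C_2 = 8`, `D_2 = 3`, `C_p = 3p + (4/p)((p-1)C_{p-2} + D_{p-2})` and
`D_p = 1 + (4/p)(C_{p-2} + (p-1)D_{p-2})`. -/
noncomputable def sagaCD : ℕ → ℝ × ℝ
  | 0 => (8, 3)
  | m + 1 =>
    (3 * (2 * (m + 2) : ℝ) + 4 / (2 * (m + 2) : ℝ) *
        (((2 * (m + 2) : ℝ) - 1) * (sagaCD m).1 + (sagaCD m).2),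
     1 + 4 / (2 * (m + 2) : ℝ) *
        ((sagaCD m).1 + ((2 * (m + 2) : ℝ) - 1) * (sagaCD m).2))

/-- Weighted Young inequality with natural exponents. -/
theorem add_mul_pow_mul_pow_le {x y : ℝ} (hx : 0 ≤ x) (hy : 0 ≤ y) (i j : ℕ) (h : i + j ≠ 0) :
    ((i : ℝ) + j) * (x ^ i * y ^ j) ≤ i * x ^ (i + j) + j * y ^ (i + j) := by
  have hn : (0 : ℝ) < (i : ℝ) + j := by exact_mod_cast Nat.pos_of_ne_zero h
  have root : ∀ {z : ℝ}, 0 ≤ z → ∀ k : ℕ, (z ^ (i + j)) ^ ((k : ℝ) / ((i : ℝ) + j)) = z ^ k := by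
    intro z hz k
    rw [← Real.rpow_natCast z (i + j), ← Real.rpow_mul hz, ← Real.rpow_natCast z k]
    congr 1
    push_cast
    field_simp
  have key := Real.geom_mean_le_arith_mean2_weighted (w₁ := i / ((i : ℝ) + j))
    (w₂ := j / ((i : ℝ) + j)) (by positivity) (by positivity)
    (pow_nonneg hx (i + j)) (pow_nonneg hy (i + j)) (by field_simp)
  rw [root hx, root hy] at key
  calc ((i : ℝ) + j) * (x ^ i * y ^ j)
      ≤ ((i : ℝ) + j) * (i / ((i : ℝ) + j) * x ^ (i + j) + j / ((i : ℝ) + j) * y ^ (i + j)) := by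
        gcongr
    _ = i * x ^ (i + j) + j * y ^ (i + j) := by field_simp

theorem sagaCD_pos (m : ℕ) : 0 < (sagaCD m).1 ∧ 0 < (sagaCD m).2 := by
  induction m with
  | zero => norm_num [sagaCD]
  | succ m ih =>
    obtain ⟨hC, hD⟩ := ih
    have h : (0 : ℝ) < 2 * (m + 2) - 1 := by
      have : (0 : ℝ) ≤ m := m.cast_nonneg
      linarith
    simp only [sagaCD]
    constructor <;> positivity

/-- Scalar form of the inequality, with `x = ‖a‖`, `y = ‖b‖` and `s = ⟪a, b⟫`. -/
theorem sq_add_two_mul_add_sq_pow_le {x y s : ℝ} (hx : 0 ≤ x) (hy : 0 ≤ y) (hs : |s| ≤ x * y)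
    (m : ℕ) :
    (x ^ 2 + 2 * s + y ^ 2) ^ (m + 2) ≤
      x ^ (2 + 2 * (m + 1)) + (2 + 2 * (m + 1) : ℝ) * s * x ^ (2 * (m + 1)) +
        (sagaCD m).1 * x ^ (2 * (m + 1)) * y ^ 2 + (sagaCD m).2 * y ^ (2 + 2 * (m + 1)) := by
  have hs1 : s ≤ x * y := (le_abs_self s).trans hs
  have hs2 : s ^ 2 ≤ (x * y) ^ 2 := sq_le_sq.mpr (by rwa [abs_of_nonneg (mul_nonneg hx hy)])
  induction m with
  | zero =>
    have hsy : s * y ^ 2 ≤ x * y * y ^ 2 := by gcongr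
    simp only [sagaCD, Nat.cast_zero]
    linear_combination 4 * hs2 + 4 * hsy + 2 * mul_nonneg (sq_nonneg (x - y)) (sq_nonneg y)
  | succ m ih =>
    obtain ⟨hC, hD⟩ := sagaCD_pos m
    simp only [sagaCD]
    set C := (sagaCD m).1
    set D := (sagaCD m).2
    have hN : 0 ≤ x ^ 2 + 2 * s + y ^ 2 := by
      nlinarith [neg_abs_le s, sq_nonneg (x - y)]
    have hmul := mul_le_mul_of_nonneg_right ih hN
    have hr : (2 * ((m : ℝ) + 2)) * (2 * ((m : ℝ) + 2))⁻¹ = 1 := mul_inv_cancel₀ (by positivity)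
    have hr0 : 0 ≤ (2 * ((m : ℝ) + 2))⁻¹ := by positivity
    simp only [div_eq_mul_inv]
    generalize (2 * ((m : ℝ) + 2))⁻¹ = r at hr hr0 ⊢
    have young : ∀ i j : ℕ, i + j = 2 * m + 4 →
        x ^ i * y ^ j * y ^ 2 ≤
          ((1 - j * r) * x ^ (2 * m + 4) + j * r * y ^ (2 * m + 4)) * y ^ 2 := by
      intro i j hij
      have h := add_mul_pow_mul_pow_le hx hy i j (by omega)
      have hc : (i : ℝ) = 2 * (m + 2) - j := by
        have : ((i + j : ℕ) : ℝ) = ((2 * m + 4 : ℕ) : ℝ) := by rw [hij]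
        push_cast at this
        linarith
      rw [hij, hc] at h
      refine mul_le_mul_of_nonneg_right ?_ (sq_nonneg y)
      have h' := mul_le_mul_of_nonneg_left h hr0
      linear_combination h' + (x ^ (2 * m + 4) - x ^ i * y ^ j) * hr
    have y1 := young (2 * m + 3) 1 (by ring)
    have y2 := young (2 * m + 2) 2 (by ring)
    have y3 := young 2 (2 * m + 2) (by ring)
    have y4 := young 1 (2 * m + 3) (by ring)
    have y5 := mul_le_mul_of_nonneg_right
      (add_mul_pow_mul_pow_le hx hy (2 * m + 3) 1 (by omega)) (sq_nonneg y)
    have e1 : s ^ 2 * (2 * (2 * (m + 2)) * x ^ (2 * m + 2)) ≤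
        (x * y) ^ 2 * (2 * (2 * (m + 2)) * x ^ (2 * m + 2)) := by gcongr
    have e2 : s * ((2 * C + 2 * (m + 2)) * x ^ (2 * m + 2) * y ^ 2 + 2 * D * y ^ (2 * m + 4)) ≤
        x * y * ((2 * C + 2 * (m + 2)) * x ^ (2 * m + 2) * y ^ 2 + 2 * D * y ^ (2 * m + 4)) := by
      gcongr
    push_cast at *
    linear_combination hmul + e1 + e2 + 2 * C * y1 + C * y2 + D * y3 + 2 * D * y4 + y5 +
      ((-4 * C - 3 * D) * x ^ (2 * m + 4) * y ^ 2 - D * y ^ (2 * m + 6)) * hr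

theorem saga_stmt6 (d : ℕ) (m : ℕ) :
    0 < (sagaCD m).1 ∧ 0 < (sagaCD m).2 ∧
      ∀ a b : EuclideanSpace ℝ (Fin d),
        ‖a + b‖ ^ (2 + 2 * (m + 1)) ≤
          ‖a‖ ^ (2 + 2 * (m + 1)) +
            (2 + 2 * (m + 1) : ℝ) * ⟪a, b⟫ * ‖a‖ ^ (2 * (m + 1)) +
            (sagaCD m).1 * ‖a‖ ^ (2 * (m + 1)) * ‖b‖ ^ 2 +
            (sagaCD m).2 * ‖b‖ ^ (2 + 2 * (m + 1)) := by
  refine ⟨(sagaCD_pos m).1, (sagaCD_pos m).2, fun a b => ?_⟩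
  have h := sq_add_two_mul_add_sq_pow_le (norm_nonneg a) (norm_nonneg b)
    (abs_real_inner_le_norm a b) m
  rwa [← norm_add_sq_real, ← pow_mul, show 2 * (m + 2) = 2 + 2 * (m + 1) by ring] at h
end
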